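/- arXiv:1701.04888 — 3 statements merged into one kernel-verified Lean document; each statement's English description precedes it below -/
import Mathlib

section
/- Let G1 and G2 be loopy graphs on the same finite vertex set. If G2 is obtained from G1 by a single valid double edge swap and G1 belongs to class Q1, then G2 also belongs to class Q1 (class Q1 is closed under valid double edge swaps). -/
open scoped Classical

/-- A loopy graph: at most one edge between any two distinct vertices and at most one
self-loop at each vertex, encoded as a symmetric adjacency relation. -/
structure LoopyGraph (V : Type) where
  Adj : V → V → Prop
  symm : ∀ u v : V, Adj u v → Adj v u

namespace LoopyGraph

variable {V : Type}

/-- The neighbors of `u` (vertices other than `u` adjacent to `u`). -/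
def nbr (G : LoopyGraph V) (u : V) : Set V := {v | v ≠ u ∧ G.Adj u v}

/-- Degree of a vertex: each self-loop contributes `2`. -/
noncomputable def deg (G : LoopyGraph V) (u : V) : ℕ :=
  (G.nbr u).ncard + (if G.Adj u u then 2 else 0)

/-- `G₂` is obtained from `G₁` by a single valid double edge swap
`(u,v),(x,y) ⤳ (u,x),(v,y)`: the two removed edges are distinct edges of `G₁`, the two
added edges are distinct and not already present (no multiedge and no doubled
self-loop is created). -/
def DoubleEdgeSwap (G₁ G₂ : LoopyGraph V) : Prop :=
  ∃ u v x y : V,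
    G₁.Adj u v ∧ G₁.Adj x y ∧
    s(u, v) ≠ s(x, y) ∧
    ¬ G₁.Adj u x ∧ ¬ G₁.Adj v y ∧ s(u, x) ≠ s(v, y) ∧
    ∀ a b : V, G₂.Adj a b ↔
      ((G₁.Adj a b ∧ s(a, b) ≠ s(u, v) ∧ s(a, b) ≠ s(x, y)) ∨
        s(a, b) = s(u, x) ∨ s(a, b) = s(v, y))

/-- `G₂` is reachable from `G₁` by a finite sequence of valid double edge swaps. -/
def Reach (G₁ G₂ : LoopyGraph V) : Prop :=
  Relation.ReflTransGen DoubleEdgeSwap G₁ G₂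

/-- Vertices at (shortest-path) distance at most `k` from the set of loop-free vertices. -/
def within (G : LoopyGraph V) : ℕ → Set V
  | 0 => {v | ¬ G.Adj v v}
  | (k + 1) => within G k ∪ {v | ∃ u ∈ within G k, G.Adj v u}

/-- `Vset G 0 = V^0` is the set of vertices with no self-loop; for `k ≥ 1`,
`Vset G k = V^k` is the set of vertices (necessarily carrying a self-loop) whose
shortest-path distance to `V^0` is exactly `k`. -/
def Vset (G : LoopyGraph V) : ℕ → Set V
  | 0 => {v | ¬ G.Adj v v}
  | (k + 1) => within G (k + 1) \ within G k

/-- `V^∞`: vertices (with a self-loop) having no path to `V^0`. -/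
def Vinf (G : LoopyGraph V) : Set V := {v | ∀ k : ℕ, v ∉ within G k}

/-- A set of vertices is a clique when all pairs of distinct members are adjacent. -/
def IsClique (G : LoopyGraph V) (s : Set V) : Prop :=
  ∀ x ∈ s, ∀ y ∈ s, x ≠ y → G.Adj x y

/-- The set of vertices carrying a self-loop. -/
def selfLoops (G : LoopyGraph V) : Set V := {v | G.Adj v v}

/-- The edges of `G` with both endpoints in `V^0`. -/
def V0edges (G : LoopyGraph V) : Set (Sym2 V) :=
  {e | ∃ u v : V, e = s(u, v) ∧ G.Adj u v ∧ u ∈ Vset G 0 ∧ v ∈ Vset G 0}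

/-- `Ĝ` is swap-maximal: among all loopy graphs reachable from it by double edge swaps it
has the maximum number of self-loops, and subject to that the maximum number of edges with
both endpoints in `V^0`. -/
def SwapMaximal (G : LoopyGraph V) : Prop :=
  ∀ H : LoopyGraph V, Reach G H →
    (selfLoops H).ncard ≤ (selfLoops G).ncard ∧
      ((selfLoops H).ncard = (selfLoops G).ncard →
        (V0edges H).ncard ≤ (V0edges G).ncard)

/-- `K` is a largest clique contained in `V^0`, and it has exactly `d` vertices. -/
def LargestV0Clique (G : LoopyGraph V) (K : Set V) (d : ℕ) : Prop :=
  K ⊆ Vset G 0 ∧ IsClique G K ∧ K.ncard = d ∧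
    ∀ K' : Set V, K' ⊆ Vset G 0 → IsClique G K' → K'.ncard ≤ d

/-- Class `Q1`. -/
def Q1 (G : LoopyGraph V) : Prop :=
  ∃ K : Set V, K ⊆ Vset G 0 ∧ 4 ≤ K.ncard ∧ IsClique G K ∧
    (∀ u ∈ Vset G 0, (∀ w ∈ Vset G 0, ¬ G.Adj u w) ∨ u ∈ K) ∧
    IsClique G (Vset G 1 ∪ K) ∧
    Vset G 2 = ∅ ∧ Vinf G = ∅

/-- Class `Q2`. -/
def Q2 (G : LoopyGraph V) : Prop :=
  3 ≤ {u | u ∈ Vset G 0 ∧ (nbr G u ∩ Vset G 0).ncard = 2}.ncard ∧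
  (∀ u ∈ Vset G 0,
      (∀ w ∈ Vset G 0, ¬ G.Adj u w) ∨
        ((nbr G u ∩ Vset G 0).ncard = 2 ∧ ∀ w ∈ Vset G 1, G.Adj u w)) ∧
  IsClique G (Vset G 1) ∧
  (∀ u ∈ Vset G 2, nbr G u = Vset G 1) ∧
  Vset G 3 = ∅ ∧
  (Vinf G = ∅ ∨ (Vset G 1 = ∅ ∧ ∀ u ∈ Vinf G, deg G u = 2))

/-- The graph of loopy graphs `𝒢({k_i})` is connected: any two loopy graphs with degree
sequence `k` are linked by a finite sequence of valid double edge swaps. -/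
def GConnected (k : V → ℕ) : Prop :=
  ∀ G₁ G₂ : LoopyGraph V, (∀ v, deg G₁ v = k v) → (∀ v, deg G₂ v = k v) →
    Reach G₁ G₂

/-- `G₂` is obtained from `G₁` by a single valid triangle-loop swap: either a triangle on
three distinct vertices is replaced by three self-loops, or conversely. -/
def TriangleLoopSwap (G₁ G₂ : LoopyGraph V) : Prop :=
  ∃ u v w : V, u ≠ v ∧ v ≠ w ∧ u ≠ w ∧
    ((G₁.Adj u v ∧ G₁.Adj v w ∧ G₁.Adj w u ∧
        ¬ G₁.Adj u u ∧ ¬ G₁.Adj v v ∧ ¬ G₁.Adj w w ∧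
        ∀ a b : V, G₂.Adj a b ↔
          ((G₁.Adj a b ∧ s(a, b) ≠ s(u, v) ∧ s(a, b) ≠ s(v, w) ∧ s(a, b) ≠ s(w, u)) ∨
            s(a, b) = s(u, u) ∨ s(a, b) = s(v, v) ∨ s(a, b) = s(w, w))) ∨
      (G₁.Adj u u ∧ G₁.Adj v v ∧ G₁.Adj w w ∧
        ¬ G₁.Adj u v ∧ ¬ G₁.Adj v w ∧ ¬ G₁.Adj w u ∧
        ∀ a b : V, G₂.Adj a b ↔
          ((G₁.Adj a b ∧ s(a, b) ≠ s(u, u) ∧ s(a, b) ≠ s(v, v) ∧ s(a, b) ≠ s(w, w)) ∨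
            s(a, b) = s(u, v) ∨ s(a, b) = s(v, w) ∨ s(a, b) = s(w, u))))

/-- Reachability in the augmented graph of loopy graphs `𝒢_△`: a finite sequence of moves,
each a valid double edge swap or a valid triangle-loop swap. -/
def ReachTri (G₁ G₂ : LoopyGraph V) : Prop :=
  Relation.ReflTransGen
    (fun H₁ H₂ => DoubleEdgeSwap H₁ H₂ ∨ TriangleLoopSwap H₁ H₂) G₁ G₂

/-- `S` is a set of highest-degree vertices for the degree sequence `k`. -/
def TopSet (k : V → ℕ) (S : Set V) : Prop :=
  ∀ u ∈ S, ∀ v : V, v ∉ S → k v ≤ k u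

/-- A loopy graph is simple when it has no self-loops. -/
def IsSimple (G : LoopyGraph V) : Prop := ∀ v : V, ¬ G.Adj v v

/-- `k` is the degree sequence of some simple graph. -/
def SimpleGraphical (k : V → ℕ) : Prop :=
  ∃ G : LoopyGraph V, IsSimple G ∧ ∀ v, deg G v = k v

/-- `k` is `m`-simple-graphical: subtracting `2` from each of the `m` largest entries
yields a simple-graphical sequence. -/
def MSimpleGraphical (k : V → ℕ) (m : ℕ) : Prop :=
  ∃ S : Set V, S.ncard = m ∧ TopSet k S ∧ (∀ v ∈ S, 2 ≤ k v) ∧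
    SimpleGraphical (fun v : V => if v ∈ S then k v - 2 else k v)

/-- `m` is `m*`, the maximum `m` for which the sequence is `m`-simple-graphical. -/
def IsMStar (k : V → ℕ) (m : ℕ) : Prop :=
  MSimpleGraphical k m ∧ ∀ m' : ℕ, MSimpleGraphical k m' → m' ≤ m

/-- `G` is `m`-loopy: it has self-loops exactly at `m` highest-degree vertices. -/
def MLoopy (G : LoopyGraph V) (m : ℕ) : Prop :=
  (selfLoops G).ncard = m ∧ TopSet (deg G) (selfLoops G)

end LoopyGraph

namespace LoopyGraph

/-- The vertices split into a loop-free clique `K`, a loop-free independent set `I` with no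
edges to `K`, and a remaining set of looped vertices which together with `K` forms a clique. -/
structure IsSplit {V : Type} (G : LoopyGraph V) (K I : Set V) : Prop where
  not_mem : ∀ a ∈ K, a ∉ I
  adj_iff : ∀ a b, a ∉ I → b ∉ I → (G.Adj a b ↔ ¬ (a = b ∧ a ∈ K))
  not_mem_of_adj : ∀ a b, a ∈ I → G.Adj a b → b ∉ I ∧ b ∉ K

/-- If no vertex is at distance exactly two from `V^0`, then every vertex within finite distance
of `V^0` is within distance one. -/
theorem within_subset_one {V : Type} {G : LoopyGraph V} (h : Vset G 2 = ∅) (k : ℕ) :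
    within G k ⊆ within G 1 := by
  have h2 : within G 2 ⊆ within G 1 := Set.sdiff_eq_empty.mp h
  induction k with
  | zero => exact Set.subset_union_left
  | succ k ih =>
    rintro v (hv | ⟨u, hu, huv⟩)
    · exact ih hv
    · exact h2 (Or.inr ⟨u, ih hu, huv⟩)

theorem Q1.exists_isSplit {V : Type} {G : LoopyGraph V} (hQ : G.Q1) :
    ∃ K I : Set V, 4 ≤ K.ncard ∧ G.IsSplit K I := by
  obtain ⟨K, hK0, hcard, -, hI, hclique, h2, hinf⟩ := hQ
  have hloop : ∀ v, G.Adj v v → v ∈ Vset G 1 := by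
    intro v hv
    have hv' : v ∉ Vinf G := by simp [hinf]
    simp only [Vinf, Set.mem_ofPred_eq, not_forall, not_not] at hv'
    obtain ⟨k, hk⟩ := hv'
    exact ⟨within_subset_one h2 k hk, fun h => h hv⟩
  have hK : ∀ v ∈ K, ¬ G.Adj v v := hK0
  have hindep : ∀ u, ¬ G.Adj u u → (∀ w, ¬ G.Adj w w → ¬ G.Adj u w) ∨ u ∈ K := hI
  have hmem : ∀ v, ¬ (¬ G.Adj v v ∧ v ∉ K) → v ∈ Vset G 1 ∪ K := by
    intro v hv
    by_cases h : v ∈ K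
    · exact Or.inr h
    · exact Or.inl (hloop v (by tauto))
  refine ⟨K, {v | ¬ G.Adj v v ∧ v ∉ K}, hcard, fun a ha h => h.2 ha, ?_, ?_⟩
  · intro a b ha hb
    by_cases hab : a = b
    · subst hab
      simp only [Set.mem_ofPred_eq] at ha
      have := hK a
      tauto
    · simp only [hab, false_and, not_false_eq_true, iff_true]
      exact hclique a (hmem a ha) b (hmem b hb) hab
  · rintro a b ⟨ha, haK⟩ hab
    have hb : G.Adj b b := by
      by_contra hb
      exact (hindep a ha).elim (fun h => h b hb hab) haK
    exact ⟨fun h => h.1 hb, fun h => hK b h hb⟩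

theorem IsSplit.q1 {V : Type} {G : LoopyGraph V} {K I : Set V} (hG : G.IsSplit K I)
    (hcard : 4 ≤ K.ncard) : G.Q1 := by
  obtain ⟨hdisj, hadj, hI⟩ := hG
  obtain ⟨c, hc⟩ : K.Nonempty := Set.nonempty_of_ncard_ne_zero (by omega)
  have hK0 : ∀ v ∈ K, ¬ G.Adj v v := by grind
  have hone : ∀ v, v ∈ within G 1 := by
    intro v
    by_cases hv : G.Adj v v
    · exact Or.inr ⟨c, hK0 c hc, by grind⟩
    · exact Or.inl hv
  have hloop : ∀ v ∈ Vset G 1, G.Adj v v := fun v hv => not_not.mp hv.2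
  have hnI : ∀ v ∈ Vset G 1 ∪ K, v ∉ I := by
    rintro v (hv | hv) hvI
    · exact (hI v v hvI (hloop v hv)).1 hvI
    · exact hdisj v hv hvI
  have hclique : IsClique G (Vset G 1 ∪ K) := fun a ha b hb hab =>
    (hadj a b (hnI a ha) (hnI b hb)).mpr fun h => hab h.1
  refine ⟨K, hK0, hcard, fun a ha b hb => hclique a (Or.inr ha) b (Or.inr hb), ?_, hclique,
    Set.sdiff_eq_empty.mpr fun v _ => hone v, ?_⟩
  · intro u hu
    have hu' : ¬ G.Adj u u := hu
    by_cases huK : u ∈ K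
    · exact Or.inr huK
    · refine Or.inl fun w hw huw => ?_
      have hw' : ¬ G.Adj w w := hw
      have huI : u ∈ I := by grind
      have := hI u w huI huw
      grind
  · ext v
    simp only [Vinf, Set.mem_ofPred_eq, Set.mem_empty_iff_false, iff_false, not_forall, not_not]
    exact ⟨1, hone v⟩

theorem IsSplit.of_doubleEdgeSwap {V : Type} {G₁ G₂ : LoopyGraph V} {K I : Set V}
    (hG : G₁.IsSplit K I) (hswap : DoubleEdgeSwap G₁ G₂) : G₂.IsSplit K I := by
  obtain ⟨u, v, x, y, huv, hxy, hne, hux, hvy, -, hadj₂⟩ := hswap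
  obtain ⟨hdisj, hadj, hI⟩ := hG
  simp only [Sym2.eq_iff, ne_eq] at hne hadj₂
  have hvu := G₁.symm _ _ huv
  have hyx := G₁.symm _ _ hxy
  have key : (u ∈ I ∧ y ∈ I ∧ v ∉ I ∧ x ∉ I ∧ v ∉ K ∧ x ∉ K) ∨
      (v ∈ I ∧ x ∈ I ∧ u ∉ I ∧ y ∉ I ∧ u ∉ K ∧ y ∉ K) := by
    have h1 := hI u v
    have h2 := hI v u
    have h3 := hI x y
    have h4 := hI y x
    have h5 := hadj u x
    have h6 := hadj v y
    have h7 := hadj u v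
    have h8 := hadj x y
    grind
  refine ⟨hdisj, fun a b ha hb => ?_, fun a b ha hab => ?_⟩
  · rw [hadj₂, ← hadj a b ha hb]
    grind
  · rw [hadj₂] at hab
    have := hI a b ha
    grind

end LoopyGraph

/-- Class `Q1` is closed under valid double edge swaps. -/
theorem Q1_closed_under_double_edge_swap {V : Type} [Fintype V]
    (G₁ G₂ : LoopyGraph V) (hswap : LoopyGraph.DoubleEdgeSwap G₁ G₂)
    (hQ : G₁.Q1) : G₂.Q1 := by
  obtain ⟨K, I, hcard, hG⟩ := hQ.exists_isSplit
  exact (hG.of_doubleEdgeSwap hswap).q1 hcard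
end

section
/- Let G1 and G2 be loopy graphs on the same finite vertex set. If G2 is obtained from G1 by a single valid double edge swap and G1 belongs to class Q2, then G2 also belongs to class Q2 (class Q2 is closed under valid double edge swaps). -/
open scoped Classical

namespace LoopyGraph

variable {V : Type}

theorem adj_comm (G : LoopyGraph V) {a b : V} : G.Adj a b ↔ G.Adj b a :=
  ⟨G.symm a b, G.symm b a⟩

theorem adj_iff_of_sym2_eq (G : LoopyGraph V) {a b p q : V} (h : s(a, b) = s(p, q)) :
    G.Adj a b ↔ G.Adj p q := by
  rcases Sym2.eq_iff.1 h with ⟨rfl, rfl⟩ | ⟨rfl, rfl⟩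
  · rfl
  · exact G.adj_comm

section Degree

variable [Fintype V]

theorem deg_eq_sum (G : LoopyGraph V) (a : V) :
    G.deg a = ∑ b, if G.Adj a b then (if b = a then 2 else 1) else 0 := by
  have h₁ : (G.nbr a).ncard = ∑ b, if b ≠ a ∧ G.Adj a b then 1 else 0 := by
    rw [← Finset.card_filter, ← Set.ncard_coe_finset]
    congr 1
    ext b
    simp [nbr]
  have h₂ : (if G.Adj a a then 2 else 0) =
      ∑ b, if b = a then (if G.Adj a a then 2 else 0) else 0 := by
    simp
  rw [deg, h₁, h₂, ← Finset.sum_add_distrib]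
  refine Finset.sum_congr rfl fun b _ => ?_
  by_cases hb : b = a
  · subst hb
    simp
  · simp [hb]

theorem sum_incidence (a p q : V) :
    (∑ b, if s(a, b) = s(p, q) then (if b = a then 2 else 1) else 0) =
      (if a = p then 1 else 0) + (if a = q then 1 else 0) := by
  have h : ∀ b : V, (if s(a, b) = s(p, q) then (if b = a then 2 else 1) else 0) =
      (if b = q then (if a = p then 1 else 0) else 0) +
        (if b = p then (if a = q then 1 else 0) else 0) := by
    intro b
    simp only [Sym2.eq_iff]
    grind
  simp_rw [h, Finset.sum_add_distrib]
  simp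

theorem DoubleEdgeSwap.deg_eq {G₁ G₂ : LoopyGraph V} (h : DoubleEdgeSwap G₁ G₂) (a : V) :
    G₂.deg a = G₁.deg a := by
  obtain ⟨u, v, x, y, huv, hxy, hne, hux, hvy, hne', hadj⟩ := h
  have key : ∀ b : V,
      (if G₂.Adj a b then (if b = a then 2 else 1) else 0) +
        (if s(a, b) = s(u, v) then (if b = a then 2 else 1) else 0) +
        (if s(a, b) = s(x, y) then (if b = a then 2 else 1) else 0) =
      (if G₁.Adj a b then (if b = a then 2 else 1) else 0) +
        (if s(a, b) = s(u, x) then (if b = a then 2 else 1) else 0) +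
        (if s(a, b) = s(v, y) then (if b = a then 2 else 1) else 0) := by
    intro b
    have h₁ := @adj_iff_of_sym2_eq _ G₁ a b u v
    have h₂ := @adj_iff_of_sym2_eq _ G₁ a b x y
    have h₃ := @adj_iff_of_sym2_eq _ G₁ a b u x
    have h₄ := @adj_iff_of_sym2_eq _ G₁ a b v y
    have h₅ := hadj a b
    generalize (if b = a then 2 else 1) = w
    grind
  have hsum := Finset.sum_congr (rfl : (Finset.univ : Finset V) = Finset.univ)
    fun b _ => key b
  simp only [Finset.sum_add_distrib, sum_incidence] at hsum
  rw [deg_eq_sum, deg_eq_sum]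
  omega

end Degree

/-- The loopy graph keeping only the edges with both endpoints in `D`. -/
def restrict (G : LoopyGraph V) (D : Set V) : LoopyGraph V where
  Adj a b := G.Adj a b ∧ a ∈ D ∧ b ∈ D
  symm _ _ h := ⟨G.symm _ _ h.1, h.2.2, h.2.1⟩

theorem DoubleEdgeSwap.restrict {G₁ G₂ : LoopyGraph V} {D : Set V} {u v x y : V}
    (hu : u ∈ D) (hv : v ∈ D) (hx : x ∈ D) (hy : y ∈ D)
    (huv : G₁.Adj u v) (hxy : G₁.Adj x y) (hne : s(u, v) ≠ s(x, y))
    (hux : ¬ G₁.Adj u x) (hvy : ¬ G₁.Adj v y) (hne' : s(u, x) ≠ s(v, y))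
    (hadj : ∀ a b : V, G₂.Adj a b ↔
      ((G₁.Adj a b ∧ s(a, b) ≠ s(u, v) ∧ s(a, b) ≠ s(x, y)) ∨
        s(a, b) = s(u, x) ∨ s(a, b) = s(v, y))) :
    DoubleEdgeSwap (G₁.restrict D) (G₂.restrict D) := by
  refine ⟨u, v, x, y, ⟨huv, hu, hv⟩, ⟨hxy, hx, hy⟩, hne, fun h => hux h.1,
    fun h => hvy h.1, hne', fun a b => ?_⟩
  have h := hadj a b
  simp only [LoopyGraph.restrict, Sym2.eq_iff, ne_eq] at h ⊢
  grind

/-- `A` is complete to `A ∪ D` (loops included), `D` induces a `2`-regular loopy graph that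
does not consist of loops only, and vertices outside `A ∪ D` are adjacent only to `A`. -/
structure TwoRegularCore (G : LoopyGraph V) (A D : Set V) : Prop where
  disjoint : ∀ a ∈ A, a ∉ D
  adj : ∀ a ∈ A, ∀ w, w ∈ A ∨ w ∈ D → G.Adj a w
  not_adj : ∀ w, w ∉ A → w ∉ D → ∀ z ∉ A, ¬ G.Adj w z
  deg_eq_two : ∀ d ∈ D, (G.restrict D).deg d = 2
  exists_loopless : ∃ d ∈ D, ¬ G.Adj d d

namespace TwoRegularCore

variable {G : LoopyGraph V} {A D : Set V}

theorem ncard_nbr (h : TwoRegularCore G A D) {d : V} (hd : d ∈ D) (hl : ¬ G.Adj d d) :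
    ((G.restrict D).nbr d).ncard = 2 := by
  have h2 := h.deg_eq_two d hd
  rwa [deg, if_neg fun h => hl h.1, add_zero] at h2

theorem mem_D_of_loop (h : TwoRegularCore G A D) {w : V} (hl : G.Adj w w) (hA : w ∉ A) :
    w ∈ D := by
  by_contra hD
  exact h.not_adj w hA hD w hA hl

/-- The edges involved in a valid swap lie inside `D`, or both join `A` to the vertices
outside `A ∪ D`. -/
theorem swap_cases (h : TwoRegularCore G A D) {u v x y : V} (huv : G.Adj u v)
    (hxy : G.Adj x y) (hux : ¬ G.Adj u x) (hvy : ¬ G.Adj v y) :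
    (u ∈ D ∧ v ∈ D ∧ x ∈ D ∧ y ∈ D) ∨
      (u ∈ A ∧ y ∈ A ∧ (v ∉ A ∧ v ∉ D) ∧ x ∉ A ∧ x ∉ D) ∨
      (v ∈ A ∧ x ∈ A ∧ (u ∉ A ∧ u ∉ D) ∧ y ∉ A ∧ y ∉ D) := by
  have hvu := G.symm _ _ huv
  have hyx := G.symm _ _ hxy
  have hxu : ¬ G.Adj x u := fun h' => hux (G.symm _ _ h')
  have hyv : ¬ G.Adj y v := fun h' => hvy (G.symm _ _ h')
  have h₁ : ∀ p q, G.Adj p q → p ∉ A → p ∉ D → q ∈ A := fun p q hpq hpA hpD =>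
    by_contra fun hq => h.not_adj p hpA hpD q hq hpq
  have h₂ : ∀ p q, ¬ G.Adj p q → p ∈ A → q ∉ A ∧ q ∉ D := fun p q hpq hp =>
    not_or.1 fun hq => hpq (h.adj p hp q hq)
  by_cases hu : u ∈ A
  · have hx := h₂ _ _ hux hu
    have hy := h₁ _ _ hxy hx.1 hx.2
    exact .inr (.inl ⟨hu, hy, h₂ _ _ hyv hy, hx⟩)
  by_cases hv : v ∈ A
  · have hy := h₂ _ _ hvy hv
    have hx := h₁ _ _ hyx hy.1 hy.2
    exact .inr (.inr ⟨hv, hx, h₂ _ _ hxu hx, hy⟩)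
  have huD : u ∈ D := by_contra fun huD => hv (h₁ _ _ huv hu huD)
  have hvD : v ∈ D := by_contra fun hvD => hu (h₁ _ _ hvu hv hvD)
  have hx : x ∉ A := fun hx => (h₂ _ _ hxu hx).2 huD
  have hy : y ∉ A := fun hy => (h₂ _ _ hyv hy).2 hvD
  exact .inl ⟨huD, hvD, by_contra fun hxD => hy (h₁ _ _ hxy hx hxD),
    by_contra fun hyD => hx (h₁ _ _ hyx hy hyD)⟩

variable [Fintype V]

theorem eq_of_loop (h : TwoRegularCore G A D) {d e : V} (hd : d ∈ D) (he : e ∈ D)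
    (hl : G.Adj d d) (hde : G.Adj d e) : e = d := by
  by_contra hne
  have h2 := h.deg_eq_two d hd
  rw [deg, if_pos ⟨hl, hd, hd⟩] at h2
  have h0 : ((G.restrict D).nbr d).ncard = 0 := by omega
  rw [Set.ncard_eq_zero (Set.toFinite _)] at h0
  have : e ∈ (G.restrict D).nbr d := ⟨hne, hde, hd, he⟩
  simp [h0] at this

theorem exists_three_loopless (h : TwoRegularCore G A D) :
    ∃ d e f, d ≠ e ∧ d ≠ f ∧ e ≠ f ∧ (d ∈ D ∧ ¬ G.Adj d d) ∧ (e ∈ D ∧ ¬ G.Adj e e) ∧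
      (f ∈ D ∧ ¬ G.Adj f f) := by
  obtain ⟨d, hd, hl⟩ := h.exists_loopless
  obtain ⟨e, f, hef, hN⟩ := Set.ncard_eq_two.1 (h.ncard_nbr hd hl)
  have he : e ∈ (G.restrict D).nbr d := by simp [hN]
  have hf : f ∈ (G.restrict D).nbr d := by simp [hN]
  obtain ⟨hed, hde, -, heD⟩ := he
  obtain ⟨hfd, hdf, -, hfD⟩ := hf
  exact ⟨d, e, f, hed.symm, hfd.symm, hef, ⟨hd, hl⟩,
    ⟨heD, fun hl' => hed (h.eq_of_loop heD hd hl' (G.symm _ _ hde)).symm⟩,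
    ⟨hfD, fun hl' => hfd (h.eq_of_loop hfD hd hl' (G.symm _ _ hdf)).symm⟩⟩

theorem nbr_inter_Vset_zero (h : TwoRegularCore G A D) {d : V} (hd : d ∈ D) :
    G.nbr d ∩ G.Vset 0 = (G.restrict D).nbr d := by
  ext e
  constructor
  · rintro ⟨⟨hne, hde⟩, hel⟩
    refine ⟨hne, hde, hd, ?_⟩
    by_contra heD
    have heA : e ∉ A := fun heA => hel (h.adj e heA e (.inl heA))
    exact h.not_adj e heA heD d (fun hdA => h.disjoint d hdA hd) (G.symm _ _ hde)
  · rintro ⟨hne, hde, -, heD⟩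
    exact ⟨⟨hne, hde⟩, fun hel => hne (h.eq_of_loop heD hd hel (G.symm _ _ hde)).symm⟩

theorem Vset_one (h : TwoRegularCore G A D) : G.Vset 1 = A := by
  ext w
  simp only [Vset, within, Set.mem_sdiff, Set.mem_union, Set.mem_ofPred_eq]
  constructor
  · rintro ⟨hw | ⟨z, hz, hwz⟩, hwl⟩
    · exact absurd hw hwl
    · by_contra hA
      have hzA : z ∉ A := fun hzA => hz (h.adj z hzA z (.inl hzA))
      by_cases hwD : w ∈ D
      · by_cases hzD : z ∈ D
        · have := h.eq_of_loop hwD hzD (not_not.1 hwl) hwz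
          exact hwl (this ▸ hz)
        · exact h.not_adj z hzA hzD w hA (G.symm _ _ hwz)
      · exact h.not_adj w hA hwD z hzA hwz
  · intro hw
    obtain ⟨d, hd, hdl⟩ := h.exists_loopless
    exact ⟨.inr ⟨d, hdl, h.adj w hw d (.inr hd)⟩, not_not.2 (h.adj w hw w (.inl hw))⟩

theorem mem_within_one (h : TwoRegularCore G A D) {w : V} :
    w ∈ G.within 1 ↔ ¬ G.Adj w w ∨ w ∈ A := by
  rw [← h.Vset_one]
  simp only [Vset, within, Set.mem_sdiff, Set.mem_union, Set.mem_ofPred_eq]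
  tauto

theorem nbr_of_loop (h : TwoRegularCore G A D) {w : V} (hl : G.Adj w w) (hA : w ∉ A) :
    G.nbr w = A := by
  have hD := h.mem_D_of_loop hl hA
  ext z
  constructor
  · rintro ⟨hne, hwz⟩
    by_contra hzA
    by_cases hzD : z ∈ D
    · exact hne (h.eq_of_loop hD hzD hl hwz)
    · exact h.not_adj z hzA hzD w hA (G.symm _ _ hwz)
  · intro hz
    exact ⟨fun hzw => hA (hzw ▸ hz), G.symm _ _ (h.adj z hz w (.inr hD))⟩

theorem mem_within_two (h : TwoRegularCore G A D) (hA : A.Nonempty) (w : V) :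
    w ∈ G.within 2 := by
  by_cases hw : w ∈ G.within 1
  · exact .inl hw
  · rw [h.mem_within_one, not_or, not_not] at hw
    obtain ⟨a, ha⟩ := hA
    exact .inr ⟨a, h.mem_within_one.2 (.inr ha),
      G.symm _ _ (h.adj a ha w (.inr (h.mem_D_of_loop hw.1 hw.2)))⟩

theorem within_eq_zero (h : TwoRegularCore G A D) (hA : A = ∅) (k : ℕ) :
    G.within k = G.within 0 := by
  induction k with
  | zero => rfl
  | succ k ih =>
    have h1 : G.within 1 = G.within 0 := by
      ext w
      rw [h.mem_within_one, hA]
      simp [within]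
    conv_rhs => rw [← h1]
    simp only [within] at ih ⊢
    rw [ih]

theorem q2 (h : TwoRegularCore G A D) : G.Q2 := by
  refine ⟨?_, ?_, ?_, ?_, ?_, ?_⟩
  · obtain ⟨d, e, f, hde, hdf, hef, hd, he, hf⟩ := h.exists_three_loopless
    have hcard : ({d, e, f} : Set V).ncard = 3 :=
      Set.ncard_eq_three.2 ⟨d, e, f, hde, hdf, hef, rfl⟩
    rw [← hcard]
    refine Set.ncard_le_ncard ?_ (Set.toFinite _)
    have key : ∀ z, z ∈ D ∧ ¬ G.Adj z z → z ∈ G.Vset 0 ∧ (G.nbr z ∩ G.Vset 0).ncard = 2 :=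
      fun z hz => ⟨hz.2, by rw [h.nbr_inter_Vset_zero hz.1, h.ncard_nbr hz.1 hz.2]⟩
    rintro z (rfl | rfl | rfl)
    exacts [key _ hd, key _ he, key _ hf]
  · intro u hu
    by_cases hD : u ∈ D
    · right
      refine ⟨by rw [h.nbr_inter_Vset_zero hD, h.ncard_nbr hD hu], fun w hw => ?_⟩
      rw [h.Vset_one] at hw
      exact G.symm _ _ (h.adj w hw u (.inr hD))
    · left
      intro w hw
      exact h.not_adj u (fun hA => hu (h.adj u hA u (.inl hA))) hD w
        fun hA => hw (h.adj w hA w (.inl hA))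
  · rw [h.Vset_one]
    exact fun a ha b hb _ => h.adj a ha b (.inl hb)
  · rintro u ⟨-, hu⟩
    rw [h.mem_within_one, not_or, not_not] at hu
    rw [h.Vset_one, h.nbr_of_loop hu.1 hu.2]
  · rw [Set.eq_empty_iff_forall_notMem]
    rintro u ⟨hu, hu'⟩
    rcases A.eq_empty_or_nonempty with hA | hA
    · rw [h.within_eq_zero hA] at hu hu'
      exact hu' hu
    · exact hu' (h.mem_within_two hA u)
  · rcases A.eq_empty_or_nonempty with hA | hA
    · right
      refine ⟨by rw [h.Vset_one, hA], fun u hu => ?_⟩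
      have hl : G.Adj u u := not_not.1 (hu 0)
      have hN := h.nbr_of_loop hl (by simp [hA])
      rw [deg, hN, hA, if_pos hl, Set.ncard_empty]
    · left
      rw [Set.eq_empty_iff_forall_notMem]
      exact fun u hu => hu 2 (h.mem_within_two hA u)

theorem doubleEdgeSwap {G' : LoopyGraph V} (h : TwoRegularCore G A D)
    (hswap : DoubleEdgeSwap G G') : TwoRegularCore G' A D := by
  obtain ⟨u, v, x, y, huv, hxy, hne, hux, hvy, hne', hadj⟩ := hswap
  have hdis := h.disjoint
  rcases h.swap_cases huv hxy hux hvy with ⟨hu, hv, hx, hy⟩ | hcross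
  · refine ⟨hdis, fun a ha w hw => ?_, fun w hwA hwD z hz => ?_, fun d hd => ?_, ?_⟩
    · have := h.adj a ha w hw
      have := hdis a ha
      rw [hadj, ne_eq, ne_eq, Sym2.eq_iff, Sym2.eq_iff]
      grind
    · have := h.not_adj w hwA hwD z hz
      rw [hadj]
      simp only [Sym2.eq_iff]
      grind
    · rw [(DoubleEdgeSwap.restrict hu hv hx hy huv hxy hne hux hvy hne' hadj).deg_eq]
      exact h.deg_eq_two d hd
    · by_contra! hall
      obtain ⟨d, e, f, hde, hdf, hef, hd, he, hf⟩ := h.exists_three_loopless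
      have key : ∀ z, z ∈ D ∧ ¬ G.Adj z z → z = u ∨ z = v := by
        intro z hz
        have := (hadj z z).1 (hall z hz.1)
        simp only [Sym2.eq_iff] at this
        have := hz.2
        tauto
      have := key d hd
      have := key e he
      have := key f hf
      grind
  · have hin : ∀ a b, (a ∈ D ∨ a ∈ A) → (b ∈ D ∨ b ∈ A) → (G'.Adj a b ↔ G.Adj a b) := by
      intro a b ha hb
      rw [hadj]
      simp only [ne_eq, Sym2.eq_iff]
      grind
    refine ⟨hdis, fun a ha w hw => (hin a w (.inr ha) hw.symm).2 (h.adj a ha w hw),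
      fun w hwA hwD z hz => ?_, fun d hd => ?_, ?_⟩
    · have := h.not_adj w hwA hwD z hz
      rw [hadj]
      simp only [Sym2.eq_iff]
      grind
    · have hr : G'.restrict D = G.restrict D := by
        simp only [LoopyGraph.restrict, LoopyGraph.mk.injEq]
        ext a b
        exact and_congr_left fun hab => hin a b (.inl hab.1) (.inl hab.2)
      rw [hr]
      exact h.deg_eq_two d hd
    · obtain ⟨d, hd, hl⟩ := h.exists_loopless
      exact ⟨d, hd, fun h' => hl ((hin d d (.inl hd) (.inl hd)).1 h')⟩

end TwoRegularCore

theorem mem_Vset_one_of_adj {G : LoopyGraph V} {w z : V} (hz : ¬ G.Adj z z)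
    (hwz : G.Adj w z) (hw : G.Adj w w) : w ∈ G.Vset 1 :=
  ⟨.inr ⟨z, hz, hwz⟩, not_not.2 hw⟩

theorem within_eq_two_of_Vset_three {G : LoopyGraph V} (h : G.Vset 3 = ∅) (k : ℕ) :
    G.within (k + 2) = G.within 2 := by
  induction k with
  | zero => rfl
  | succ k ih =>
    have h3 : G.within 3 = G.within 2 :=
      (Set.sdiff_eq_empty.1 h).antisymm Set.subset_union_left
    conv_rhs => rw [← h3]
    change G.within (k + 2) ∪ {v | ∃ u ∈ G.within (k + 2), G.Adj v u} = _
    rw [ih]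
    rfl

theorem mem_Vset_two_or_Vinf {G : LoopyGraph V} (h : G.Vset 3 = ∅) {w : V}
    (hl : G.Adj w w) (hw : w ∉ G.Vset 1) : w ∈ G.Vset 2 ∨ w ∈ G.Vinf := by
  have h1 : w ∉ G.within 1 := fun h1 => hw ⟨h1, not_not.2 hl⟩
  by_cases h2 : w ∈ G.within 2
  · exact .inl ⟨h2, h1⟩
  · right
    intro k hk
    match k with
    | 0 => exact hk hl
    | 1 => exact h1 hk
    | k + 2 => exact h2 (within_eq_two_of_Vset_three h k ▸ hk)

theorem Q2.twoRegularCore [Fintype V] {G : LoopyGraph V} (h : G.Q2) :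
    TwoRegularCore G (G.Vset 1)
      {w | (¬ G.Adj w w ∧ ∃ z, ¬ G.Adj z z ∧ G.Adj w z) ∨
        (G.Adj w w ∧ w ∉ G.Vset 1)} := by
  obtain ⟨hthree, hV0, hclique, hV2, hV3, hinf⟩ := h
  have hloop : ∀ a ∈ G.Vset 1, G.Adj a a := fun a ha => not_not.1 ha.2
  have hnbr : ∀ w, G.Adj w w → w ∉ G.Vset 1 → G.nbr w = G.Vset 1 := by
    intro w hl hw
    rcases mem_Vset_two_or_Vinf hV3 hl hw with h2 | hi
    · exact hV2 w h2
    · rcases hinf with h0 | ⟨h1, hdeg⟩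
      · simp [h0] at hi
      · have := hdeg w hi
        rw [deg, if_pos hl] at this
        rw [h1, ← Set.ncard_eq_zero (Set.toFinite _)]
        omega
  refine ⟨?_, ?_, ?_, ?_, ?_⟩
  · rintro a ha (⟨hl, -⟩ | ⟨-, hA⟩)
    · exact hl (hloop a ha)
    · exact hA ha
  · rintro a ha w (hw | ⟨hl, z, hz, hwz⟩ | ⟨hl, hw⟩)
    · by_cases haw : a = w
      · exact haw ▸ hloop a ha
      · exact hclique a ha w hw haw
    · rcases hV0 w hl with h0 | ⟨-, h1⟩
      · exact absurd hwz (h0 z hz)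
      · exact G.symm _ _ (h1 a ha)
    · have haw : a ∈ G.nbr w := hnbr w hl hw ▸ ha
      exact G.symm _ _ haw.2
  · intro w hwA hwD z hz hwz
    simp only [Set.mem_ofPred_eq, not_or, not_and, not_not, not_exists] at hwD
    have hl : ¬ G.Adj w w := fun hl => hwA (hwD.2 hl)
    have hzl : G.Adj z z := by
      by_contra hzl
      exact hwD.1 hl z hzl hwz
    exact hz (mem_Vset_one_of_adj hl (G.symm _ _ hwz) hzl)
  · intro d hd
    rw [deg]
    rcases id hd with ⟨hl, z, hz, hdz⟩ | ⟨hl, hA⟩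
    · rw [if_neg fun h' => hl h'.1, add_zero]
      rcases hV0 d hl with h0 | ⟨h2, -⟩
      · exact absurd hdz (h0 z hz)
      · rw [← h2]
        congr 1
        ext e
        constructor
        · rintro ⟨hne, hde, -, ⟨hel, -⟩ | ⟨hel, heA⟩⟩
          · exact ⟨⟨hne, hde⟩, hel⟩
          · exact absurd (mem_Vset_one_of_adj hl (G.symm _ _ hde) hel) heA
        · rintro ⟨⟨hne, hde⟩, hel⟩
          exact ⟨hne, hde, hd, .inl ⟨hel, d, hl, G.symm _ _ hde⟩⟩
    · rw [if_pos ⟨hl, hd, hd⟩, Nat.add_eq_right, Set.ncard_eq_zero (Set.toFinite _),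
        Set.eq_empty_iff_forall_notMem]
      rintro e ⟨hne, hde, -, heD⟩
      have he : e ∈ G.Vset 1 := hnbr d hl hA ▸ ⟨hne, hde⟩
      rcases heD with ⟨hel, -⟩ | ⟨-, heA⟩
      · exact hel (hloop e he)
      · exact heA he
  · obtain ⟨d, hdl, hd⟩ :=
      Set.nonempty_of_ncard_ne_zero (Nat.ne_of_gt (Nat.lt_of_lt_of_le three_pos hthree))
    obtain ⟨e, ⟨-, hde⟩, hel⟩ := Set.nonempty_of_ncard_ne_zero (hd.trans_ne two_ne_zero)
    exact ⟨d, .inl ⟨hdl, e, hel, hde⟩, hdl⟩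

end LoopyGraph

/-- Class `Q2` is closed under valid double edge swaps. -/
theorem Q2_closed_under_double_edge_swap {V : Type} [Fintype V]
    (G₁ G₂ : LoopyGraph V) (hswap : LoopyGraph.DoubleEdgeSwap G₁ G₂)
    (hQ : G₁.Q2) : G₂.Q2 :=
  (hQ.twoRegularCore.doubleEdgeSwap hswap).q2
end

section
/- If some loopy graph with degree sequence {k_i} belongs to class Q1 or to class Q2, then the graph of loopy graphs 𝒢({k_i}) is disconnected. -/
open scoped Classical

namespace LoopyGraph

variable {V : Type}

theorem mem_Vset_one {G : LoopyGraph V} {v : V} :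
    v ∈ G.Vset 1 ↔ G.Adj v v ∧ ∃ u, ¬ G.Adj u u ∧ G.Adj v u := by
  simp only [Vset, within, Set.mem_sdiff, Set.mem_union, Set.mem_ofPred_eq]
  tauto

theorem within_subset_of_Vset_succ_eq_empty {G : LoopyGraph V} {k : ℕ}
    (h : G.Vset (k + 1) = ∅) (n : ℕ) : G.within n ⊆ G.within k := by
  have hstep : G.within (k + 1) ⊆ G.within k := Set.sdiff_eq_empty.mp h
  induction n with
  | zero =>
    intro v hv
    clear h hstep
    induction k with
    | zero => exact hv
    | succ k ih => exact Or.inl ih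
  | succ n ih =>
    rintro v (hv | ⟨u, hu, huv⟩)
    · exact ih hv
    · exact hstep (Or.inr ⟨u, ih hu, huv⟩)

/-- `A` is a looped clique joined to all of `M`, `G` is prescribed by `R` on `M`, and vertices
outside `A ∪ M` have neighbors in `A` only. -/
structure HasCore (A M : Set V) (R : V → V → Prop) (G : LoopyGraph V) : Prop where
  adj_of_mem : ∀ a ∈ A, ∀ b ∈ A ∪ M, G.Adj a b
  adj_iff : ∀ a ∈ M, ∀ b ∈ M, (G.Adj a b ↔ R a b)
  mem_of_adj : ∀ a ∉ A ∪ M, ∀ b, G.Adj a b → b ∈ A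

/-- A core is preserved by swaps when the graph prescribed on `M` admits no valid swap. -/
theorem HasCore.doubleEdgeSwap {A M : Set V} {R : V → V → Prop}
    (hR : ∀ u v x y, R u v → R x y → ¬ R u x → ¬ R v y →
      s(u, v) ≠ s(x, y) → s(u, x) = s(v, y))
    {G H : LoopyGraph V} (hG : G.HasCore A M R) (hGH : G.DoubleEdgeSwap H) :
    H.HasCore A M R := by
  obtain ⟨u, v, x, y, huv, hxy, hne, hux, hvy, hne', hH⟩ := hGH
  obtain ⟨h₁, h₂, h₃⟩ := hG
  have hvu := G.symm _ _ huv
  have hyx := G.symm _ _ hxy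
  have hxu : ¬ G.Adj x u := fun h => hux (G.symm _ _ h)
  have hyv : ¬ G.Adj y v := fun h => hvy (G.symm _ _ h)
  have hnon : ∀ a b, ¬ G.Adj a b → a ∈ A → b ∉ A ∪ M := fun a b h ha hb => h (h₁ a ha b hb)
  have key : (u ∉ A ∪ M ∧ v ∈ A ∧ y ∉ A ∪ M ∧ x ∈ A) ∨
      (u ∈ A ∧ v ∉ A ∪ M ∧ y ∈ A ∧ x ∉ A ∪ M) := by
    by_cases hu : u ∈ A ∪ M
    · by_cases hv : v ∈ A ∪ M
      · exfalso
        have hx : x ∈ A ∪ M := by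
          by_contra hx
          exact hnon y v hyv (h₃ x hx y hxy) hv
        have hy : y ∈ A ∪ M := by
          by_contra hy
          exact hnon x u hxu (h₃ y hy x hyx) hu
        have mem_M : ∀ a b, ¬ G.Adj a b → a ∈ A ∪ M → b ∈ A ∪ M → a ∈ M :=
          fun a b h ha hb => ha.resolve_left fun ha => hnon a b h ha hb
        have huM := mem_M u x hux hu hx
        have hvM := mem_M v y hvy hv hy
        have hxM := mem_M x u hxu hx hu
        have hyM := mem_M y v hyv hy hv
        rw [h₂ u huM v hvM] at huv
        rw [h₂ x hxM y hyM] at hxy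
        rw [h₂ u huM x hxM] at hux
        rw [h₂ v hvM y hyM] at hvy
        exact hne' (hR u v x y huv hxy hux hvy hne)
      · have hu := h₃ v hv u hvu
        have hx := hnon u x hux hu
        exact Or.inr ⟨hu, hv, h₃ x hx y hxy, hx⟩
    · have hv := h₃ u hu v huv
      have hy := hnon v y hvy hv
      exact Or.inl ⟨hu, hv, hy, h₃ y hy x hyx⟩
  clear hR hnon hne hne' hux hvy hxu hyv huv hxy hvu hyx
  simp only [Set.mem_union] at key h₁ h₃
  refine ⟨fun a ha b hb => ?_, fun a ha b hb => ?_, fun a ha b hab => ?_⟩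
  · have hab := h₁ a ha b hb
    rw [Set.mem_union] at hb
    simp only [hH, ne_eq, Sym2.eq_iff]
    clear hH h₁ h₂ h₃
    grind
  · rw [← h₂ a ha b hb]
    simp only [hH, ne_eq, Sym2.eq_iff]
    clear hH h₁ h₂ h₃
    grind
  · rw [Set.mem_union] at ha
    simp only [hH, ne_eq, Sym2.eq_iff] at hab
    have := h₃ a ha b
    clear hH h₁ h₂ h₃
    grind

theorem HasCore.reach {A M : Set V} {R : V → V → Prop}
    (hR : ∀ u v x y, R u v → R x y → ¬ R u x → ¬ R v y →
      s(u, v) ≠ s(x, y) → s(u, x) = s(v, y))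
    {G H : LoopyGraph V} (hG : G.HasCore A M R) (hGH : G.Reach H) : H.HasCore A M R := by
  induction hGH with
  | refl => exact hG
  | tail _ h ih => exact ih.doubleEdgeSwap hR h

/-- Replace the edges in `E` by self-loops at the vertices of `C`. -/
def loopify (G : LoopyGraph V) (C : Set V) (E : V → V → Prop)
    (hE : ∀ a b, E a b → E b a) : LoopyGraph V where
  Adj a b := (G.Adj a b ∧ ¬ E a b) ∨ (a = b ∧ a ∈ C)
  symm a b := by
    rintro (⟨h, h'⟩ | ⟨rfl, h⟩)
    · exact Or.inl ⟨G.symm _ _ h, fun h => h' (hE _ _ h)⟩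
    · exact Or.inr ⟨rfl, h⟩

theorem deg_loopify [Finite V] (G : LoopyGraph V) (C : Set V) (E : V → V → Prop)
    (hE : ∀ a b, E a b → E b a) (hEG : ∀ a b, E a b → a ∈ C ∧ b ∈ G.nbr a)
    (hloop : ∀ a ∈ C, ¬ G.Adj a a) (hcard : ∀ a ∈ C, {b | E a b}.ncard = 2) (a : V) :
    (G.loopify C E hE).deg a = G.deg a := by
  have hnbr : (G.loopify C E hE).nbr a = G.nbr a \ {b | E a b} := by
    ext b
    simp only [nbr, loopify, Set.mem_sdiff, Set.mem_ofPred_eq]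
    grind
  have hsub : {b | E a b} ⊆ G.nbr a := fun b hb => (hEG a b hb).2
  have hle := Set.ncard_le_ncard hsub
  rw [deg, deg, hnbr, Set.ncard_sdiff hsub]
  by_cases ha : a ∈ C
  · rw [hcard a ha] at hle ⊢
    have : (G.loopify C E hE).Adj a a := Or.inr ⟨rfl, ha⟩
    rw [if_pos this, if_neg (hloop a ha)]
    omega
  · have hempty : {b | E a b} = ∅ := by
      ext b
      simpa using fun hb => ha (hEG a b hb).1
    have : (G.loopify C E hE).Adj a a ↔ G.Adj a a := by
      have : ¬ E a a := fun h => ha (hEG a a h).1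
      simp [loopify, ha, this]
    simp [hempty, this]

theorem Q1.not_gConnected [Finite V] {k : V → ℕ} {G : LoopyGraph V} (hdeg : ∀ v, G.deg v = k v)
    (hQ : G.Q1) : ¬ GConnected k := by
  intro hconn
  obtain ⟨K, hK0, hK4, hK, hV0, hclique, hV2, hinf⟩ := hQ
  obtain ⟨C, hCK, hC3⟩ := Set.exists_subset_card_eq (s := K) (n := 3) (by omega)
  let E : V → V → Prop := fun a b => a ∈ C ∧ b ∈ C ∧ b ≠ a
  have hE : ∀ a b, E a b → E b a := fun a b h => ⟨h.2.1, h.1, h.2.2.symm⟩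
  have hloop : ∀ a ∈ C, ¬ G.Adj a a := fun a ha => hK0 (hCK ha)
  have hdeg' := G.deg_loopify C E hE
    (fun a b h => ⟨h.1, h.2.2, hK a (hCK h.1) b (hCK h.2.1) h.2.2.symm⟩) hloop
    (fun a ha => by
      have : {b | E a b} = C \ {a} := by
        ext b
        simp [E, ha]
      rw [this, Set.ncard_sdiff_singleton_of_mem ha, hC3])
  have hcore : G.HasCore (G.Vset 1) K (· ≠ ·) := by
    refine ⟨fun a ha b hb => ?_, fun a ha b hb => ⟨?_, fun h => hK a ha b hb h⟩,
      fun a ha b hab => ?_⟩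
    · by_cases h : a = b
      · exact h ▸ (mem_Vset_one.mp ha).1
      · exact hclique a (Or.inl ha) b hb h
    · rintro h rfl
      exact hK0 ha h
    · have ha0 : a ∈ G.Vset 0 := by
        intro hloop
        have : a ∉ G.Vinf := by simp [hinf]
        simp only [Vinf, Set.mem_ofPred_eq, not_forall, not_not] at this
        obtain ⟨n, hn⟩ := this
        exact ha (Or.inl ⟨within_subset_of_Vset_succ_eq_empty hV2 n hn, fun h => h hloop⟩)
      have hb : G.Adj b b := by
        by_contra hb
        exact (hV0 a ha0).elim (fun h => h b hb hab) fun h => ha (Or.inr h)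
      exact mem_Vset_one.mpr ⟨hb, a, ha0, G.symm _ _ hab⟩
  obtain ⟨c, hc⟩ := Set.nonempty_of_ncard_ne_zero (s := C) (by omega)
  have := hcore.reach (by grind) (hconn _ _ hdeg fun v => (hdeg' v).trans (hdeg v))
  exact (this.adj_iff c (hCK hc) c (hCK hc)).mp (Or.inr ⟨rfl, hc⟩) rfl

theorem Q2.not_gConnected [Finite V] {k : V → ℕ} {G : LoopyGraph V} (hdeg : ∀ v, G.deg v = k v)
    (hQ : G.Q2) : ¬ GConnected k := by
  intro hconn
  obtain ⟨h3, hV0, hV1, hV2, hV3, hinf⟩ := hQ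
  set C : Set V := {u | u ∈ G.Vset 0 ∧ (G.nbr u ∩ G.Vset 0).ncard = 2} with hC
  let E : V → V → Prop := fun a b => a ∈ G.Vset 0 ∧ b ∈ G.Vset 0 ∧ G.Adj a b
  have hE : ∀ a b, E a b → E b a := fun a b h => ⟨h.2.1, h.1, G.symm _ _ h.2.2⟩
  have hmemC : ∀ a b, E a b → a ∈ C := fun a b h =>
    ⟨h.1, (hV0 a h.1).elim (fun h' => (h' b h.2.1 h.2.2).elim) And.left⟩
  have hne : ∀ a b, E a b → b ≠ a := by
    rintro a b h rfl
    exact h.1 h.2.2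
  have hdeg' := G.deg_loopify C E hE
    (fun a b h => ⟨hmemC a b h, hne a b h, h.2.2⟩) (fun a ha => ha.1)
    (fun a ha => by
      rw [← ha.2]
      congr 1
      ext b
      have := hne a b
      have := ha.1
      simp only [E, nbr, Set.mem_inter_iff, Set.mem_ofPred_eq] at *
      tauto)
  have hloops : ∀ b, G.Adj b b → b ∉ G.Vset 1 → G.nbr b = G.Vset 1 := by
    intro b hb hb1
    by_cases hbinf : b ∈ G.Vinf
    · obtain hinf | ⟨hA, hinf⟩ := hinf
      · simp [hinf] at hbinf
      · have := hinf b hbinf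
        rw [deg, if_pos hb] at this
        rw [hA, ← Set.ncard_eq_zero]
        omega
    · simp only [Vinf, Set.mem_ofPred_eq, not_forall, not_not] at hbinf
      obtain ⟨n, hn⟩ := hbinf
      exact hV2 b ⟨within_subset_of_Vset_succ_eq_empty hV3 n hn,
        fun h => hb1 ⟨h, fun h0 => h0 hb⟩⟩
  let M : Set V := C ∪ {v | G.Adj v v ∧ v ∉ G.Vset 1}
  have hCA : ∀ c ∈ C, ∀ a ∈ G.Vset 1, G.Adj c a := by
    intro c hc a ha
    obtain h | h := hV0 c hc.1
    · obtain ⟨w, hw⟩ := Set.nonempty_of_ncard_ne_zero (s := G.nbr c ∩ G.Vset 0)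
        (by rw [hc.2]; norm_num)
      exact (h w hw.2 hw.1.2).elim
    · exact h.2 a ha
  have hcore : (G.loopify C E hE).HasCore (G.Vset 1) M (· = ·) := by
    refine ⟨fun a ha b hb => ?_, fun a ha b hb => ⟨?_, ?_⟩, fun a ha b hab => ?_⟩
    · have haa := (mem_Vset_one.mp ha).1
      refine Or.inl ⟨?_, fun h => h.1 haa⟩
      by_cases hab : a = b
      · exact hab ▸ haa
      obtain hb | hb | ⟨hb, hb'⟩ := hb
      · exact hV1 a ha b hb hab
      · exact G.symm _ _ (hCA b hb a ha)
      · rw [← hloops b hb hb'] at ha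
        exact G.symm _ _ ha.2
    · rintro (⟨hab, hnE⟩ | ⟨h, -⟩)
      · by_contra hne
        obtain ha | ⟨ha, ha'⟩ := ha
        · obtain hb | ⟨hb, hb'⟩ := hb
          · exact hnE ⟨ha.1, hb.1, hab⟩
          · exact hb' (mem_Vset_one.mpr ⟨hb, a, ha.1, G.symm _ _ hab⟩)
        · have hbA : b ∈ G.Vset 1 := hloops a ha ha' ▸ ⟨Ne.symm hne, hab⟩
          obtain hb | ⟨-, hb'⟩ := hb
          · exact hb.1 (mem_Vset_one.mp hbA).1
          · exact hb' hbA
      · exact h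
    · rintro rfl
      obtain ha | ⟨ha, -⟩ := ha
      · exact Or.inr ⟨rfl, ha⟩
      · exact Or.inl ⟨ha, fun h => h.1 ha⟩
    · have haC : a ∉ C := fun h => ha (Or.inr (Or.inl h))
      have ha0 : ¬ G.Adj a a := fun h =>
        ha (or_iff_not_imp_left.mpr fun h1 => Or.inr ⟨h, h1⟩)
      obtain ⟨hab, hnE⟩ | ⟨-, h⟩ := hab
      · have hb : G.Adj b b := by
          by_contra hb
          exact hnE ⟨ha0, hb, hab⟩
        exact mem_Vset_one.mpr ⟨hb, a, ha0, G.symm _ _ hab⟩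
      · exact (haC h).elim
  obtain ⟨c, hc⟩ := Set.nonempty_of_ncard_ne_zero (s := C) (by omega)
  have := hcore.reach (by grind) (hconn _ _ (fun v => (hdeg' v).trans (hdeg v)) hdeg)
  exact hc.1 ((this.adj_iff c (Or.inl hc) c (Or.inl hc)).mpr rfl)

end LoopyGraph

/-- If some loopy graph with degree sequence `k` belongs to class `Q1` or to
class `Q2`, then the graph of loopy graphs `𝒢(k)` is disconnected. -/
theorem disconnected_of_Q1_or_Q2 {V : Type} [Fintype V] (k : V → ℕ)
    (G : LoopyGraph V) (hdeg : ∀ v, G.deg v = k v) (hQ : G.Q1 ∨ G.Q2) :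
    ¬ LoopyGraph.GConnected k :=
  hQ.elim (fun h => h.not_gConnected hdeg) (fun h => h.not_gConnected hdeg)
end
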